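/- (Explicit deformed 2×2 Hermite-type MVOPs) Let a ∈ ℝ and t ∈ ℝ, and let W(x;t) be the 2×2 matrix weight W(x;t) = e^{−x²−t} [[1, ax],[ax, a²x² + e^{−t}]] on ℝ. For n ≥ 0 define the 2×2 matrix polynomial 2^n P_n(x;t) = H_n(x) I − n a [[0, 2/(na²+2e^{−t})],[1, 0]] H_{n−1}(x) + n(n−1) [[2a²/(na²+2e^{−t}), 0],[0, 0]] H_{n−2}(x), where terms with negative Hermite index are omitted and I is the 2×2 identity. Then each P_n(·;t) is a monic matrix polynomial of degree n, and for all n ≠ m, ∫_ℝ P_n(x;t) W(x;t) P_m(x;t)* dx = 0 (Lebesgue measure). -/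

import Mathlib

open Matrix MeasureTheory Polynomial

/-- The physicists' Hermite polynomials: `H₀ = 1`, `H₁ = 2x`,
`H_{n+1} = 2x H_n - 2n H_{n-1}`. -/
noncomputable def Hphys : ℕ → Polynomial ℂ
  | 0 => 1
  | 1 => Polynomial.C 2 * Polynomial.X
  | n + 2 => Polynomial.C 2 * Polynomial.X * Hphys (n + 1) -
      Polynomial.C (2 * ((n : ℂ) + 1)) * Hphys n

/-- Evaluation of a matrix polynomial at a real point: `p(x) = Σ pᵢ xⁱ`. -/
noncomputable def mEval (p : Polynomial (Matrix (Fin 2) (Fin 2) ℂ)) (x : ℝ) :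
    Matrix (Fin 2) (Fin 2) ℂ :=
  p.eval ((x : ℂ) • (1 : Matrix (Fin 2) (Fin 2) ℂ))

/-- A scalar polynomial viewed as a matrix polynomial. -/
noncomputable def scalarMP (p : Polynomial ℂ) : Polynomial (Matrix (Fin 2) (Fin 2) ℂ) :=
  p.map (algebraMap ℂ (Matrix (Fin 2) (Fin 2) ℂ))

/-- The deformed `2×2` Hermite-type weight
`W(x;t) = e^{-x²-t} [[1, ax],[ax, a²x² + e^{-t}]]`. -/
noncomputable def W2 (a t x : ℝ) : Matrix (Fin 2) (Fin 2) ℂ :=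
  Real.exp (-x ^ 2 - t) •
    !![(1 : ℂ), (a : ℂ) * (x : ℂ);
       (a : ℂ) * (x : ℂ), (a : ℂ) ^ 2 * (x : ℂ) ^ 2 + (Real.exp (-t) : ℂ)]

/-- The deformed `2×2` Hermite-type monic matrix orthogonal polynomials:
`2ⁿ P_n(x;t) = H_n(x) I - n a [[0, 2/(na²+2e^{-t})],[1, 0]] H_{n-1}(x)
  + n(n-1) [[2a²/(na²+2e^{-t}), 0],[0, 0]] H_{n-2}(x)`,
where terms with negative Hermite index are omitted (their scalar prefactors vanish). -/
noncomputable def P2 (a t : ℝ) (n : ℕ) : Polynomial (Matrix (Fin 2) (Fin 2) ℂ) :=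
  ((2 : ℂ) ^ n)⁻¹ •
    (scalarMP (Hphys n) -
      Polynomial.C (((n : ℂ) * (a : ℂ)) •
        !![(0 : ℂ), 2 / ((n : ℂ) * (a : ℂ) ^ 2 + 2 * (Real.exp (-t) : ℂ));
           1, 0]) * scalarMP (Hphys (n - 1)) +
      Polynomial.C (((n : ℂ) * ((n : ℂ) - 1)) •
        !![2 * (a : ℂ) ^ 2 / ((n : ℂ) * (a : ℂ) ^ 2 + 2 * (Real.exp (-t) : ℂ)), (0 : ℂ);
           0, 0]) * scalarMP (Hphys (n - 2)))

theorem Hphys_succ (n : ℕ) :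
    Hphys (n + 1) = C 2 * X * Hphys n - C (2 * (n : ℂ)) * Hphys (n - 1) := by
  cases n with
  | zero => simp [Hphys]
  | succ n => simp [Hphys]

theorem derivative_Hphys_succ (n : ℕ) :
    derivative (Hphys (n + 1)) = C (2 * ((n : ℂ) + 1)) * Hphys n := by
  induction n using Nat.strong_induction_on with
  | _ n ih =>
    match n with
    | 0 => simp [Hphys]
    | 1 => simp [Hphys]; ring
    | n + 2 =>
      have h1 := ih (n + 1) (by omega)
      have h0 := ih n (by omega)
      rw [Hphys, derivative_sub, derivative_mul, derivative_C_mul, derivative_C_mul, h1, h0, Hphys]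
      simp only [derivative_X, Nat.cast_add, Nat.cast_one, Nat.cast_ofNat, C_mul, C_add, C_1,
        map_ofNat, map_natCast]
      ring

theorem Hphys_succ_eq_sub_derivative (n : ℕ) :
    Hphys (n + 1) = C 2 * X * Hphys n - derivative (Hphys n) := by
  cases n with
  | zero => simp [Hphys]
  | succ n => rw [derivative_Hphys_succ, Hphys]

theorem natDegree_Hphys_le_and_coeff (n : ℕ) :
    (Hphys n).natDegree ≤ n ∧ (Hphys n).coeff n = 2 ^ n := by
  induction n with
  | zero => simp [Hphys]
  | succ n ih =>
    obtain ⟨hd, hc⟩ := ih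
    have hd' : (derivative (Hphys n)).natDegree ≤ n :=
      (natDegree_derivative_le _).trans (by omega)
    rw [Hphys_succ_eq_sub_derivative, mul_assoc]
    constructor
    · refine (natDegree_sub_le _ _).trans (max_le ?_ (by omega))
      refine (natDegree_C_mul_le _ _).trans (natDegree_mul_le.trans ?_)
      rw [natDegree_X]
      omega
    · rw [coeff_sub, coeff_C_mul, coeff_X_mul, hc,
        coeff_eq_zero_of_natDegree_lt (n := n + 1) (by omega)]
      ring

theorem natDegree_Hphys_le (n : ℕ) : (Hphys n).natDegree ≤ n :=
  (natDegree_Hphys_le_and_coeff n).1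

theorem coeff_Hphys_self (n : ℕ) : (Hphys n).coeff n = 2 ^ n :=
  (natDegree_Hphys_le_and_coeff n).2

theorem star_eval_Hphys (n : ℕ) (x : ℝ) :
    star ((Hphys n).eval (x : ℂ)) = (Hphys n).eval (x : ℂ) := by
  induction n using Nat.strong_induction_on with
  | _ n ih =>
    match n with
    | 0 => simp [Hphys]
    | 1 => simp [Hphys]
    | n + 2 =>
      have h1 := ih (n + 1) (by omega)
      have h0 := ih n (by omega)
      rw [Complex.star_def] at *
      simp [Hphys, h1, h0, map_ofNat]

theorem integrable_eval_mul_exp_neg_sq (p : ℂ[X]) :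
    Integrable fun x : ℝ => p.eval (x : ℂ) * (Real.exp (-x ^ 2) : ℂ) := by
  induction p using Polynomial.induction_on' with
  | add p q hp hq =>
    simp only [eval_add, add_mul]
    exact hp.add hq
  | monomial n c =>
    have h := (integrable_rpow_mul_exp_neg_mul_sq (b := 1) one_pos (s := n)
      (by have := Nat.cast_nonneg (α := ℝ) n; linarith)).ofReal (𝕜 := ℂ)
    simpa [mul_assoc] using h.const_mul c

/-- Integration of a complex polynomial against `e^{-x²}`. -/
noncomputable def gaussianFunctional : ℂ[X] →ₗ[ℂ] ℂ where
  toFun p := ∫ x : ℝ, p.eval (x : ℂ) * (Real.exp (-x ^ 2) : ℂ)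
  map_add' p q := by
    rw [← integral_add (integrable_eval_mul_exp_neg_sq p) (integrable_eval_mul_exp_neg_sq q)]
    simp [add_mul]
  map_smul' c p := by
    rw [RingHom.id_apply, smul_eq_mul, ← integral_const_mul]
    simp [mul_assoc]

theorem gaussianFunctional_derivative (p : ℂ[X]) :
    gaussianFunctional (derivative p) = gaussianFunctional (C 2 * X * p) := by
  rw [← sub_eq_zero, ← map_sub]
  refine integral_eq_zero_of_hasDerivAt_of_integrable (fun x => ?_)
    (integrable_eval_mul_exp_neg_sq _) (integrable_eval_mul_exp_neg_sq p)
  have hp : HasDerivAt (fun y : ℝ => p.eval (y : ℂ)) ((derivative p).eval (x : ℂ)) x :=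
    (p.hasDerivAt (x : ℂ)).comp_ofReal
  have he : HasDerivAt (fun y : ℝ => ((Real.exp (-y ^ 2) : ℝ) : ℂ))
      ((Real.exp (-x ^ 2) * (-(2 * x)) : ℝ) : ℂ) x := by
    refine HasDerivAt.ofReal_comp ?_
    simpa using ((hasDerivAt_pow 2 x).neg).exp
  refine (hp.mul he).congr_deriv ?_
  simp
  ring

theorem gaussianFunctional_Hphys_succ_mul (n : ℕ) (q : ℂ[X]) :
    gaussianFunctional (Hphys (n + 1) * q) = gaussianFunctional (Hphys n * derivative q) := by
  have h := gaussianFunctional_derivative (Hphys n * q)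
  rw [derivative_mul, map_add] at h
  rw [Hphys_succ_eq_sub_derivative, sub_mul, map_sub, mul_assoc (C 2 * X), ← h]
  ring

theorem gaussianFunctional_Hphys_succ_mul_succ (n m : ℕ) :
    gaussianFunctional (Hphys (n + 1) * Hphys (m + 1)) =
      2 * ((m : ℂ) + 1) * gaussianFunctional (Hphys n * Hphys m) := by
  rw [gaussianFunctional_Hphys_succ_mul, derivative_Hphys_succ, mul_left_comm, ← smul_eq_C_mul,
    map_smul, smul_eq_mul]

theorem gaussianFunctional_Hphys_mul_of_ne {n m : ℕ} (h : n ≠ m) :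
    gaussianFunctional (Hphys n * Hphys m) = 0 := by
  induction n generalizing m with
  | zero =>
    cases m with
    | zero => exact absurd rfl h
    | succ m => rw [mul_comm, gaussianFunctional_Hphys_succ_mul]; simp [Hphys]
  | succ n ih =>
    cases m with
    | zero => rw [gaussianFunctional_Hphys_succ_mul]; simp [Hphys]
    | succ m => rw [gaussianFunctional_Hphys_succ_mul_succ, ih (by omega), mul_zero]

theorem gaussianFunctional_Hphys_mul_succ (n m : ℕ) :
    gaussianFunctional (Hphys n * Hphys (m + 1)) =
      2 * (n : ℂ) * gaussianFunctional (Hphys (n - 1) * Hphys m) := by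
  cases n with
  | zero => rw [gaussianFunctional_Hphys_mul_of_ne (by omega)]; simp
  | succ n => rw [mul_comm, gaussianFunctional_Hphys_succ_mul_succ, mul_comm (Hphys m)]; simp

theorem natDegree_C_mul_scalarMP_le (A : Matrix (Fin 2) (Fin 2) ℂ) {n k : ℕ} (h : k ≤ n) :
    (C A * scalarMP (Hphys k)).natDegree ≤ n :=
  (natDegree_C_mul_le _ _).trans (natDegree_map_le.trans ((natDegree_Hphys_le k).trans h))

theorem coeff_scalarMP_Hphys_of_lt {n k : ℕ} (h : k < n) :
    (scalarMP (Hphys k)).coeff n = 0 := by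
  rw [scalarMP, coeff_map, coeff_eq_zero_of_natDegree_lt ((natDegree_Hphys_le k).trans_lt h),
    map_zero]

theorem natDegree_P2_le (a t : ℝ) (n : ℕ) : (P2 a t n).natDegree ≤ n := by
  refine (natDegree_smul_le _ _).trans ((natDegree_add_le _ _).trans (max_le
    ((natDegree_sub_le _ _).trans (max_le ?_ ?_)) ?_))
  · exact natDegree_map_le.trans (natDegree_Hphys_le n)
  · exact natDegree_C_mul_scalarMP_le _ (by omega)
  · exact natDegree_C_mul_scalarMP_le _ (by omega)

theorem coeff_P2_self (a t : ℝ) (n : ℕ) : (P2 a t n).coeff n = 1 := by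
  have h2 : ((2 : ℂ) ^ n)⁻¹ • (scalarMP (Hphys n)).coeff n = 1 := by
    rw [scalarMP, coeff_map, coeff_Hphys_self, Algebra.algebraMap_eq_smul_one, smul_smul,
      inv_mul_cancel₀ (pow_ne_zero n two_ne_zero), one_smul]
  rw [P2, coeff_smul, coeff_add, coeff_sub, coeff_C_mul, coeff_C_mul]
  cases n with
  | zero => simpa using h2
  | succ n =>
    rw [coeff_scalarMP_Hphys_of_lt (k := n + 1 - 1) (by omega),
      coeff_scalarMP_Hphys_of_lt (k := n + 1 - 2) (by omega)]
    simpa using h2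

theorem mEval_scalarMP (p : ℂ[X]) (x : ℝ) :
    mEval (scalarMP p) x = p.eval (x : ℂ) • (1 : Matrix (Fin 2) (Fin 2) ℂ) := by
  rw [mEval, scalarMP, eval_map_algebraMap, ← Algebra.algebraMap_eq_smul_one,
    aeval_algebraMap_apply_eq_algebraMap_eval, Algebra.algebraMap_eq_smul_one]

theorem mEval_C_mul_scalarMP (A : Matrix (Fin 2) (Fin 2) ℂ) (p : ℂ[X]) (x : ℝ) :
    mEval (C A * scalarMP p) x = p.eval (x : ℂ) • A := by
  have h := mEval_scalarMP p x
  rw [mEval] at h ⊢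
  rw [eval_C_mul, h, mul_smul_comm, mul_one]

theorem mEval_P2 (a t : ℝ) (n : ℕ) (x : ℝ) :
    mEval (P2 a t n) x = ((2 : ℂ) ^ n)⁻¹ •
      ((Hphys n).eval (x : ℂ) • (1 : Matrix (Fin 2) (Fin 2) ℂ) -
        (Hphys (n - 1)).eval (x : ℂ) • (((n : ℂ) * (a : ℂ)) •
          !![(0 : ℂ), 2 / ((n : ℂ) * (a : ℂ) ^ 2 + 2 * (Real.exp (-t) : ℂ)); 1, 0]) +
        (Hphys (n - 2)).eval (x : ℂ) • (((n : ℂ) * ((n : ℂ) - 1)) •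
          !![2 * (a : ℂ) ^ 2 / ((n : ℂ) * (a : ℂ) ^ 2 + 2 * (Real.exp (-t) : ℂ)), (0 : ℂ);
            0, 0])) := by
  rw [← mEval_scalarMP, ← mEval_C_mul_scalarMP, ← mEval_C_mul_scalarMP]
  simp only [mEval, P2, eval_smul, eval_add, eval_sub]

theorem W2_eq_mul_mul_conjTranspose (a t x : ℝ) :
    W2 a t x = (Real.exp (-x ^ 2 - t) : ℂ) •
      (!![(1 : ℂ), 0; (a : ℂ) * x, 1] * !![(1 : ℂ), 0; 0, (Real.exp (-t) : ℂ)] *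
        !![(1 : ℂ), 0; (a : ℂ) * x, 1]ᴴ) := by
  rw [W2]
  ext i j
  simp only [Matrix.smul_apply, Matrix.mul_apply, Fin.sum_univ_two, conjTranspose_apply]
  fin_cases i <;> fin_cases j <;> simp
  ring

theorem denominator_ne_zero (a t : ℝ) (n : ℕ) :
    (n : ℂ) * (a : ℂ) ^ 2 + 2 * (Real.exp (-t) : ℂ) ≠ 0 := by
  have h : 0 < (n : ℝ) * a ^ 2 + 2 * Real.exp (-t) := by positivity
  exact_mod_cast h.ne'

theorem mEval_P2_mul_triangular (a t : ℝ) (n : ℕ) (x : ℝ) :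
    mEval (P2 a t n) x * !![(1 : ℂ), 0; (a : ℂ) * x, 1] = ((2 : ℂ) ^ n)⁻¹ •
      !![2 * (Real.exp (-t) : ℂ) / ((n : ℂ) * (a : ℂ) ^ 2 + 2 * (Real.exp (-t) : ℂ)) *
          (Hphys n).eval (x : ℂ),
        -(2 * n * a / ((n : ℂ) * (a : ℂ) ^ 2 + 2 * (Real.exp (-t) : ℂ)) *
          (Hphys (n - 1)).eval (x : ℂ));
        (a : ℂ) / 2 * (Hphys (n + 1)).eval (x : ℂ), (Hphys n).eval (x : ℂ)] := by
  have hd := denominator_ne_zero a t n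
  have h1 : (n : ℂ) * (Hphys n).eval (x : ℂ) = n * (2 * x * (Hphys (n - 1)).eval (x : ℂ) -
      2 * ((n : ℂ) - 1) * (Hphys (n - 2)).eval (x : ℂ)) := by
    cases n with
    | zero => simp
    | succ n =>
      rw [Hphys_succ n, show n + 1 - 1 = n by omega, show n + 1 - 2 = n - 1 by omega]
      simp
  have h2 : (Hphys (n + 1)).eval (x : ℂ) = 2 * x * (Hphys n).eval (x : ℂ) -
      2 * n * (Hphys (n - 1)).eval (x : ℂ) := by
    rw [Hphys_succ n]
    simp
  rw [mEval_P2, smul_mul_assoc]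
  congr 1
  rw [h2]
  generalize (Real.exp (-t) : ℂ) = s at *
  ext i j
  fin_cases i <;> fin_cases j <;> simp [Matrix.mul_apply, Fin.sum_univ_two]
  · field_simp
    linear_combination (a : ℂ) ^ 2 * h1
  · ring
  · ring

theorem P2_mul_W2_mul_P2 (a t : ℝ) (n m : ℕ) (x : ℝ) :
    mEval (P2 a t n) x * W2 a t x * (mEval (P2 a t m) x)ᴴ = (Real.exp (-x ^ 2 - t) : ℂ) •
      ((mEval (P2 a t n) x * !![(1 : ℂ), 0; (a : ℂ) * x, 1]) *
        !![(1 : ℂ), 0; 0, (Real.exp (-t) : ℂ)] *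
        (mEval (P2 a t m) x * !![(1 : ℂ), 0; (a : ℂ) * x, 1])ᴴ) := by
  rw [W2_eq_mul_mul_conjTranspose, conjTranspose_mul]
  simp only [mul_smul_comm, smul_mul_assoc, Matrix.mul_assoc]

theorem integral_eq_zero_of_gaussianFunctional_eq_zero {f : ℝ → ℂ} (t : ℝ) (p : ℂ[X])
    (hf : ∀ x, f x = (Real.exp (-x ^ 2 - t) : ℂ) * p.eval (x : ℂ))
    (hp : gaussianFunctional p = 0) : ∫ x, f x = 0 := by
  have h : ∀ x, f x = (Real.exp (-t) : ℂ) * (p.eval (x : ℂ) * (Real.exp (-x ^ 2) : ℂ)) := by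
    intro x
    rw [hf, sub_eq_add_neg, Real.exp_add, Complex.ofReal_mul]
    ring
  simp_rw [h]
  rw [integral_const_mul]
  exact mul_eq_zero_of_right _ hp

/-- **Explicit deformed 2×2 Hermite-type MVOPs.** Each `P2 a t n` is a monic matrix polynomial
of degree `n`, and they are pairwise orthogonal with respect to the deformed weight `W2 a t`
(Lebesgue measure, entrywise). -/
theorem deformed_two_by_two_hermite_MVOPs (a t : ℝ) :
    (∀ n : ℕ, (P2 a t n).Monic ∧ (P2 a t n).natDegree = n) ∧
    ∀ n m : ℕ, n ≠ m → ∀ i j,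
      ∫ x : ℝ, (mEval (P2 a t n) x * W2 a t x * (mEval (P2 a t m) x)ᴴ) i j = 0 := by
  refine ⟨fun n => ⟨monic_of_natDegree_le_of_coeff_eq_one n (natDegree_P2_le a t n)
    (coeff_P2_self a t n), natDegree_eq_of_le_of_coeff_ne_zero (natDegree_P2_le a t n)
    (by rw [coeff_P2_self]; exact one_ne_zero)⟩, fun n m hnm i j => ?_⟩
  have hnm0 := gaussianFunctional_Hphys_mul_of_ne hnm
  set s : ℂ := (Real.exp (-t) : ℂ) with hs
  have hstar : star s = s := by rw [hs, Complex.star_def, Complex.conj_ofReal]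
  set dn : ℂ := (n : ℂ) * (a : ℂ) ^ 2 + 2 * s with hdn
  set dm : ℂ := (m : ℂ) * (a : ℂ) ^ 2 + 2 * s with hdm
  have hstarm : star dm = dm := by
    rw [Complex.star_def] at *
    simp [hdm, hstar, map_ofNat]
  let R (k : ℕ) (d : ℂ) : Matrix (Fin 2) (Fin 2) ℂ[X] :=
    !![C (2 * s / d) * Hphys k, -(C (2 * k * a / d) * Hphys (k - 1));
      C ((a : ℂ) / 2) * Hphys (k + 1), Hphys k]
  refine integral_eq_zero_of_gaussianFunctional_eq_zero t
    (C (((2 : ℂ) ^ n)⁻¹ * ((2 : ℂ) ^ m)⁻¹) *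
      (R n dn i 0 * R m dm j 0 + C s * (R n dn i 1 * R m dm j 1))) (fun x => ?_) ?_
  · rw [P2_mul_W2_mul_P2, mEval_P2_mul_triangular, mEval_P2_mul_triangular]
    have e := fun k => star_eval_Hphys k x
    rw [← hs, ← hdn, ← hdm]
    rw [Complex.star_def] at *
    clear_value s dn dm
    simp only [Matrix.smul_apply, Matrix.mul_apply, Fin.sum_univ_two, conjTranspose_apply]
    fin_cases i <;> fin_cases j <;> simp [R, e, hstar, hstarm] <;> ring
  · rw [← smul_eq_C_mul, map_smul, smul_eq_mul]
    refine mul_eq_zero_of_right _ ?_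
    have pull : ∀ (c d : ℂ) (p q : ℂ[X]),
        gaussianFunctional (C c * p * (C d * q)) = c * d * gaussianFunctional (p * q) := by
      intro c d p q
      rw [mul_mul_mul_comm, ← C_mul, ← smul_eq_C_mul, map_smul, smul_eq_mul]
    have pullr : ∀ (d : ℂ) (p q : ℂ[X]),
        gaussianFunctional (p * (C d * q)) = d * gaussianFunctional (p * q) := by
      intro d p q
      simpa using pull 1 d p q
    have pulll : ∀ (d : ℂ) (p q : ℂ[X]),
        gaussianFunctional (C d * p * q) = d * gaussianFunctional (p * q) := by
      intro d p q
      simpa using pull d 1 p q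
    have pred : (n : ℂ) * (m * gaussianFunctional (Hphys (n - 1) * Hphys (m - 1))) = 0 := by
      rcases Nat.eq_zero_or_pos n with rfl | hn
      · simp
      rcases Nat.eq_zero_or_pos m with rfl | hm
      · simp
      rw [gaussianFunctional_Hphys_mul_of_ne (by omega)]
      simp
    have succ := gaussianFunctional_Hphys_mul_of_ne (n := n + 1) (m := m + 1) (by omega)
    have up := gaussianFunctional_Hphys_mul_succ n m
    have down := gaussianFunctional_Hphys_mul_succ m n
    rw [mul_comm (Hphys m), mul_comm (Hphys (m - 1))] at down
    have hs' : ∀ p, gaussianFunctional (C s * p) = s * gaussianFunctional p := fun p => by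
      rw [← smul_eq_C_mul, map_smul, smul_eq_mul]
    clear_value s dn dm
    fin_cases i <;> fin_cases j <;>
      simp only [R, Fin.zero_eta, Fin.mk_one, Fin.isValue, Matrix.of_apply, Matrix.cons_val',
        Matrix.cons_val_zero, Matrix.cons_val_one, Matrix.cons_val_fin_one, map_add, hs', mul_neg,
        neg_mul, neg_neg, map_neg, pull, pulll, pullr, hnm0, succ, up, down]
    · linear_combination 4 * s * a ^ 2 / (dn * dm) * pred
    · ring
    · ring
    · ring
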